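/- Every planar point set in general position of size 9 whose convex layer structure is (4,4,1) — i.e., the convex hull has 4 vertices, the convex hull of the remaining 5 points has 4 vertices, and the last point is interior to that quadrilateral — contains an empty convex pentagon. -/

import Mathlib

open scoped Classical
noncomputable section

/-- Points in the plane. -/
abbrev Pt := ℝ × ℝ

/-- Signed area determinant of the triple (p, q, r). -/
def det (p q r : Pt) : ℝ := (q.1 - p.1) * (r.2 - p.2) - (q.2 - p.2) * (r.1 - p.1)

/-- A finite point set is in general position if no three distinct points are collinear. -/
def GenPos (S : Finset Pt) : Prop :=
  ∀ p ∈ S, ∀ q ∈ S, ∀ r ∈ S, p ≠ q → p ≠ r → q ≠ r → ¬ Collinear ℝ ({p, q, r} : Set Pt)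

/-- A finite point set is in convex position if no point lies in the
convex hull of the others. -/
def ConvexPos (S : Finset Pt) : Prop :=
  ∀ p ∈ S, p ∉ convexHull ℝ ((S.erase p : Finset Pt) : Set Pt)

/-- The vertices of the convex hull of a finite point set. -/
def hullVerts (S : Finset Pt) : Finset Pt :=
  S.filter (fun p => p ∉ convexHull ℝ ((S.erase p : Finset Pt) : Set Pt))

/-- `S` is an empty convex pentagon of the point set `P`. -/
def EmptyConvexPentagon (P S : Finset Pt) : Prop :=
  S ⊆ P ∧ S.card = 5 ∧ ConvexPos S ∧
    ∀ p ∈ P, p ∉ S → p ∉ interior (convexHull ℝ (S : Set Pt))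

/-- Type-1 beam `a : bc`: the convex cone with apex `a` spanned by the rays from `a`
through `b` and through `c`, minus the triangle `abc`. -/
def beam1 (a b c : Pt) : Set Pt :=
  {x | (∃ s t : ℝ, 0 ≤ s ∧ 0 ≤ t ∧ x = a + s • (b - a) + t • (c - a)) ∧
       x ∉ convexHull ℝ ({a, b, c} : Set Pt)}

/-- Type-2 beam `pq : rs`: the convex region bounded by the segment `pq`, the ray
from `p` through `s` and the ray from `q` through `r`, minus the quadrilateral `pqrs`. -/
def beam2 (p q r s : Pt) : Set Pt :=
  {x | (∃ y ∈ segment ℝ p q, ∃ u v : ℝ, 0 ≤ u ∧ 0 ≤ v ∧ x = y + u • (s - p) + v • (r - q)) ∧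
       x ∉ convexHull ℝ ({p, q, r, s} : Set Pt)}

/-- The O-region of triangle `abc` opposite the vertex `a`: points separated from `a`
by line `bc`, on the same side of line `ac` as `b`, and on the same side of line `ab` as `c`. -/
def ORegionOpp (a b c : Pt) : Set Pt :=
  {x | det b c x * det b c a < 0 ∧ det a c x * det a c b > 0 ∧ det a b x * det a b c > 0}

/-- The I-region of triangle (or quadrilateral) at vertex `a` relative to the remaining
vertex set `R`: points `x` such that `a` lies strictly inside the convex hull of `{x} ∪ R`. -/
def IRegion (a : Pt) (R : Set Pt) : Set Pt :=
  {x | a ∈ interior (convexHull ℝ (insert x R))}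

/-- A convex quadrilateral with vertices `a b c d` in this cyclic order. -/
def CyclicQuad (a b c d : Pt) : Prop :=
  ConvexPos ({a, b, c, d} : Finset Pt) ∧ ({a, b, c, d} : Finset Pt).card = 4 ∧
    det a c b * det a c d < 0 ∧ det b d a * det b d c < 0

lemma det_rotate (p q r : Pt) : det q r p = det p q r := by
  simp only [det]; ring

lemma det_swap (p q r : Pt) : det p r q = -det p q r := by
  simp only [det]; ring

lemma det_swap_left (p q r : Pt) : det q p r = -det p q r := by
  simp only [det]; ring

lemma collinear_of_det_eq_zero {p q r : Pt} (hpq : p ≠ q) (h : det p q r = 0) :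
    Collinear ℝ ({p, q, r} : Set Pt) := by
  rw [collinear_iff_of_mem (p₀ := p) (by simp)]
  refine ⟨q - p, ?_⟩
  simp only [det] at h
  rintro x (rfl | rfl | rfl)
  · exact ⟨0, by simp⟩
  · exact ⟨1, by simp⟩
  · by_cases h1 : q.1 - p.1 = 0
    · have h2 : q.2 - p.2 ≠ 0 := fun h2 => hpq (Prod.ext (by linarith) (by linarith))
      refine ⟨(x.2 - p.2) / (q.2 - p.2), Prod.ext ?_ ?_⟩
      · have : x.1 - p.1 = 0 := by simpa [h1, h2] using h
        simp [h1]
        linarith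
      · simp; field_simp; ring
    · refine ⟨(x.1 - p.1) / (q.1 - p.1), Prod.ext ?_ ?_⟩
      · simp; field_simp; ring
      · simp; field_simp; linarith

lemma GenPos.det_ne_zero {S : Finset Pt} (hS : GenPos S) {p q r : Pt} (hp : p ∈ S) (hq : q ∈ S)
    (hr : r ∈ S) (hpq : p ≠ q) (hpr : p ≠ r) (hqr : q ≠ r) : det p q r ≠ 0 := fun h =>
  hS p hp q hq r hr hpq hpr hqr (collinear_of_det_eq_zero hpq h)

lemma det_nonneg_of_mem_convexHull {p q x : Pt} {S : Set Pt} (hS : ∀ y ∈ S, 0 ≤ det p q y)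
    (hx : x ∈ convexHull ℝ S) : 0 ≤ det p q x := by
  refine convexHull_min (t := {y | 0 ≤ det p q y}) hS ?_ hx
  intro y hy z hz a b ha hb hab
  have : det p q (a • y + b • z) = a * det p q y + b * det p q z := by
    obtain rfl : b = 1 - a := by linarith
    simp [det]; ring
  rw [Set.mem_ofPred_eq, this]
  exact add_nonneg (mul_nonneg ha hy) (mul_nonneg hb hz)

lemma mem_convexHull_triangle {a b c x : Pt} (habc : 0 < det a b c) (hab : 0 ≤ det a b x)
    (hbc : 0 ≤ det b c x) (hca : 0 ≤ det c a x) : x ∈ convexHull ℝ ({a, b, c} : Set Pt) := by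
  have h0 := habc.ne'
  refine mem_convexHull_of_exists_fintype (ι := Fin 3)
    ![det b c x / det a b c, det c a x / det a b c, det a b x / det a b c] ![a, b, c] ?_ ?_ ?_ ?_
  · intro i
    fin_cases i <;> simp <;> positivity
  · simp only [Fin.sum_univ_three, Matrix.cons_val]
    field_simp
    simp only [det]; ring
  · intro i
    fin_cases i <;> simp
  · ext <;> simp [Fin.sum_univ_three] <;> field_simp <;> simp only [det] <;> ring

lemma subset_convexHull_hullVerts (S : Finset Pt) :
    (S : Set Pt) ⊆ convexHull ℝ (hullVerts S : Set Pt) := by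
  have hsub : (convexHull ℝ (S : Set Pt)).extremePoints ℝ ⊆ (hullVerts S : Set Pt) := by
    intro p hp
    have hpS : p ∈ S := extremePoints_convexHull_subset hp
    have hp' := ((convex_convexHull ℝ _).mem_extremePoints_iff_mem_sdiff_convexHull_sdiff.1 hp).2
    simp only [hullVerts, Finset.coe_filter, Set.mem_ofPred_eq]
    refine ⟨hpS, fun h => hp' (convexHull_mono ?_ h)⟩
    intro y hy
    rw [Finset.mem_coe, Finset.mem_erase] at hy
    exact ⟨subset_convexHull ℝ _ hy.2, hy.1⟩
  have hcompact : IsCompact (convexHull ℝ (S : Set Pt)) := S.finite_toSet.isCompact_convexHull (𝕜 := ℝ)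
  have hclosed : IsClosed (convexHull ℝ (hullVerts S : Set Pt)) :=
    ((hullVerts S).finite_toSet.isCompact_convexHull (𝕜 := ℝ)).isClosed
  calc (S : Set Pt) ⊆ convexHull ℝ S := subset_convexHull ℝ _
    _ = closure (convexHull ℝ ((convexHull ℝ (S : Set Pt)).extremePoints ℝ)) :=
      (closure_convexHull_extremePoints hcompact (convex_convexHull ℝ _)).symm
    _ ⊆ convexHull ℝ (hullVerts S : Set Pt) :=
      closure_minimal (convexHull_mono hsub) hclosed

lemma convexPos_hullVerts (S : Finset Pt) : ConvexPos (hullVerts S) := by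
  intro p hp h
  refine (Finset.mem_filter.1 hp).2 (convexHull_mono ?_ h)
  exact_mod_cast Finset.erase_subset_erase p (Finset.filter_subset _ S)

/-- The points `a`, `b`, `c`, `d` are the vertices of a convex quadrilateral, in counterclockwise
order. -/
structure CcwQuad (a b c d : Pt) : Prop where
  abc : 0 < det a b c
  bcd : 0 < det b c d
  cda : 0 < det c d a
  dab : 0 < det d a b

lemma CcwQuad.rotate {a b c d : Pt} (h : CcwQuad a b c d) : CcwQuad b c d a :=
  ⟨h.bcd, h.cda, h.dab, h.abc⟩

lemma exists_ccwQuad {S : Finset Pt} (hcard : S.card = 4) (hS : ConvexPos S) (hgp : GenPos S) :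
    ∃ p q r s, S = {p, q, r, s} ∧ CcwQuad p q r s := by
  have hnot : ∀ p q r x, S = {p, q, r, x} → 0 < det p q r → 0 < det p q x → 0 < det q r x →
      0 < det r p x → False := by
    intro p q r x hpqrx hpqr hpq hqr hrp
    refine hS x (by simp [hpqrx])
      (convexHull_mono ?_ (mem_convexHull_triangle hpqr hpq.le hqr.le hrp.le))
    intro y hy
    have hyx : y ≠ x := by
      rintro rfl
      rcases hy with rfl | rfl | rfl
      · simp [det] at hpq
      · simp [det, mul_comm] at hpq
      · simp [det] at hrp
    rw [Finset.mem_coe, Finset.mem_erase, hpqrx]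
    rcases hy with rfl | rfl | rfl <;> simp [hyx]
  obtain ⟨d, T, hdT, rfl, hT⟩ := Finset.card_eq_succ.1 hcard
  obtain ⟨a, b, c, hab, hac, hbc, rfl⟩ := Finset.card_eq_three.1 hT
  simp only [Finset.mem_insert, Finset.mem_singleton, not_or] at hdT
  obtain ⟨hda, hdb, hdc⟩ := hdT
  wlog habc : 0 < det a b c generalizing b c
  · have h := hgp.det_ne_zero (p := a) (q := b) (r := c) (by simp) (by simp) (by simp) hab hac hbc
    rw [Finset.pair_comm b c] at *
    refine this c b hac hab (Ne.symm hbc) hT hcard hS hgp hnot hdc hdb ?_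
    rw [det_swap]
    linarith [lt_of_le_of_ne (not_lt.1 habc) h]
  have hsum : det a b d + det b c d + det c a d = det a b c := by
    simp only [det]; ring
  rcases (hgp.det_ne_zero (p := a) (q := b) (r := d) (by simp) (by simp) (by simp)
    hab (Ne.symm hda) (Ne.symm hdb)).lt_or_gt with h1 | h1 <;>
  rcases (hgp.det_ne_zero (p := b) (q := c) (r := d) (by simp) (by simp) (by simp)
    hbc (Ne.symm hdb) (Ne.symm hdc)).lt_or_gt with h2 | h2 <;>
  rcases (hgp.det_ne_zero (p := c) (q := a) (r := d) (by simp) (by simp) (by simp)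
    (Ne.symm hac) (Ne.symm hdc) (Ne.symm hda)).lt_or_gt with h3 | h3
  · linarith
  · refine (hnot a d c b (by ext; simp; tauto) ?_ ?_ ?_ ?_).elim <;>
      simp only [det] at habc h1 h2 h3 ⊢ <;> linarith
  · refine (hnot c d b a (by ext; simp; tauto) ?_ ?_ ?_ ?_).elim <;>
      simp only [det] at habc h1 h2 h3 ⊢ <;> linarith
  · refine ⟨a, d, b, c, by ext; simp; tauto, ?_, ?_, ?_, ?_⟩ <;>
      simp only [det] at habc h1 h2 h3 ⊢ <;> linarith
  · refine (hnot b d a c (by ext; simp; tauto) ?_ ?_ ?_ ?_).elim <;>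
      simp only [det] at habc h1 h2 h3 ⊢ <;> linarith
  · refine ⟨b, d, c, a, by ext; simp; tauto, ?_, ?_, ?_, ?_⟩ <;>
      simp only [det] at habc h1 h2 h3 ⊢ <;> linarith
  · refine ⟨c, d, a, b, by ext; simp; tauto, ?_, ?_, ?_, ?_⟩ <;>
      simp only [det] at habc h1 h2 h3 ⊢ <;> linarith
  · exact (hnot a b c d (by ext; simp; tauto) habc h1 h2 h3).elim

lemma exists_ccwQuad_insert {S : Finset Pt} (hcard : S.card = 4) (hS : ConvexPos S) {e : Pt}
    (he : e ∉ S) (hgp : GenPos (insert e S)) :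
    ∃ p q r s, S = {p, q, r, s} ∧ CcwQuad p q r s ∧ 0 < det p e r ∧ 0 < det q s e := by
  have hS' : GenPos S := fun p hp q hq r hr =>
    hgp p (Finset.mem_insert_of_mem hp) q (Finset.mem_insert_of_mem hq) r
      (Finset.mem_insert_of_mem hr)
  obtain ⟨p, q, r, s, rfl, h⟩ := exists_ccwQuad hcard hS hS'
  have hpr : p ≠ r := by rintro rfl; simpa [det] using h.abc
  have hqs : q ≠ s := by rintro rfl; simpa [det] using h.bcd
  simp only [Finset.mem_insert, Finset.mem_singleton, not_or] at he
  have hper : det p e r ≠ 0 :=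
    hgp.det_ne_zero (by simp) (by simp) (by simp) (Ne.symm he.1) hpr he.2.2.1
  have hqse : det q s e ≠ 0 :=
    hgp.det_ne_zero (by simp) (by simp) (by simp) hqs (Ne.symm he.2.1) (Ne.symm he.2.2.2)
  rcases hper.lt_or_gt with h1 | h1 <;> rcases hqse.lt_or_gt with h2 | h2
  · refine ⟨r, s, p, q, by ext; simp; tauto, h.rotate.rotate, ?_, ?_⟩ <;> simp only [det] at * <;> linarith
  · refine ⟨s, p, q, r, by ext; simp; tauto, h.rotate.rotate.rotate, ?_, ?_⟩ <;> simp only [det] at * <;> linarith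
  · refine ⟨q, r, s, p, by ext; simp; tauto, h.rotate, ?_, ?_⟩ <;> simp only [det] at * <;> linarith
  · exact ⟨p, q, r, s, rfl, h, h1, h2⟩

/-- `a`, `b`, `c`, `d`, `e` are the vertices of a convex pentagon, in counterclockwise order. -/
def CcwPentagon (a b c d e : Pt) : Prop :=
  0 < det a b c ∧ 0 < det a b d ∧ 0 < det a b e ∧ 0 < det a c d ∧ 0 < det a c e ∧
    0 < det a d e ∧ 0 < det b c d ∧ 0 < det b c e ∧ 0 < det b d e ∧ 0 < det c d e

lemma CcwPentagon.rotate {a b c d e : Pt} (h : CcwPentagon a b c d e) :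
    CcwPentagon b c d e a := by
  obtain ⟨h1, h2, h3, h4, h5, h6, h7, h8, h9, h10⟩ := h
  refine ⟨h7, h8, ?_, h9, ?_, ?_, h10, ?_, ?_, ?_⟩ <;> rwa [det_rotate]

lemma CcwPentagon.notMem_convexHull {a b c d e : Pt} (h : CcwPentagon a b c d e) :
    a ∉ convexHull ℝ ((({a, b, c, d, e} : Finset Pt).erase a : Finset Pt) : Set Pt) := by
  obtain ⟨h1, h2, h3, h4, h5, h6, h7, h8, h9, h10⟩ := h
  intro ha
  have : 0 ≤ det e b a := by
    refine det_nonneg_of_mem_convexHull (fun y hy => ?_) ha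
    rw [Finset.mem_coe, Finset.mem_erase] at hy
    obtain ⟨hya, hy⟩ := hy
    simp only [Finset.mem_insert, Finset.mem_singleton] at hy
    rcases hy with rfl | rfl | rfl | rfl | rfl
    · exact absurd rfl hya
    · simp [det, mul_comm]
    all_goals simp only [det] at *; linarith
  simp only [det] at *; linarith

lemma pentagon_rotate (a b c d e : Pt) : ({a, b, c, d, e} : Finset Pt) = {b, c, d, e, a} := by
  ext
  simp
  tauto

lemma CcwPentagon.convexPos {a b c d e : Pt} (h : CcwPentagon a b c d e) :
    ConvexPos {a, b, c, d, e} := by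
  intro p hp
  simp only [Finset.mem_insert, Finset.mem_singleton] at hp
  rcases hp with rfl | rfl | rfl | rfl | rfl
  · exact h.notMem_convexHull
  · rw [pentagon_rotate]
    exact h.rotate.notMem_convexHull
  · rw [pentagon_rotate, pentagon_rotate]
    exact h.rotate.rotate.notMem_convexHull
  · rw [pentagon_rotate, pentagon_rotate, pentagon_rotate]
    exact h.rotate.rotate.rotate.notMem_convexHull
  · rw [pentagon_rotate, pentagon_rotate, pentagon_rotate, pentagon_rotate]
    exact h.rotate.rotate.rotate.rotate.notMem_convexHull

lemma CcwPentagon.card_eq_five {a b c d e : Pt} (h : CcwPentagon a b c d e) :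
    ({a, b, c, d, e} : Finset Pt).card = 5 := by
  have hne : ∀ {p q r : Pt}, 0 < det p q r → p ≠ q ∧ p ≠ r ∧ q ≠ r := by
    intro p q r h
    refine ⟨?_, ?_, ?_⟩ <;> rintro rfl <;> simp [det, mul_comm] at h
  obtain ⟨h1, -, -, -, -, h6, h7, -, h9, h10⟩ := h
  obtain ⟨hab, hac, hbc⟩ := hne h1
  obtain ⟨had, hae, hde⟩ := hne h6
  obtain ⟨-, hbd, hcd⟩ := hne h7
  obtain ⟨-, hbe, -⟩ := hne h9
  obtain ⟨-, hce, -⟩ := hne h10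
  simp [Finset.card_insert_of_notMem, *]

lemma CcwPentagon.det_nonneg_of_mem_convexHull {a b c d e x : Pt} (h : CcwPentagon a b c d e)
    (hx : x ∈ convexHull ℝ (({a, b, c, d, e} : Finset Pt) : Set Pt)) :
    0 ≤ det a b x ∧ 0 ≤ det b c x ∧ 0 ≤ det c d x ∧ 0 ≤ det d e x ∧ 0 ≤ det e a x := by
  obtain ⟨h1, h2, h3, h4, h5, h6, h7, h8, h9, h10⟩ := h
  refine ⟨?_, ?_, ?_, ?_, ?_⟩ <;>
  · refine _root_.det_nonneg_of_mem_convexHull (fun y hy => ?_) hx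
    simp only [Finset.mem_coe, Finset.mem_insert, Finset.mem_singleton] at hy
    simp only [det] at *
    rcases hy with rfl | rfl | rfl | rfl | rfl <;> linarith

/-- The point `x` lies outside one of the edges of the polygon `abcde`, or is one of its
vertices. -/
def OffPentagon (a b c d e x : Pt) : Prop :=
  x ∈ ({a, b, c, d, e} : Finset Pt) ∨
    0 < det b a x ∨ 0 < det c b x ∨ 0 < det d c x ∨ 0 < det e d x ∨ 0 < det a e x

lemma CcwPentagon.emptyConvexPentagon {a b c d e : Pt} {P : Finset Pt}
    (h : CcwPentagon a b c d e) (hP : {a, b, c, d, e} ⊆ P)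
    (hoff : ∀ x ∈ P, OffPentagon a b c d e x) : EmptyConvexPentagon P {a, b, c, d, e} := by
  refine ⟨hP, h.card_eq_five, h.convexPos, fun x hx hxS hxi => ?_⟩
  obtain ⟨h1, h2, h3, h4, h5⟩ := h.det_nonneg_of_mem_convexHull (interior_subset hxi)
  rw [← neg_nonpos, ← det_swap_left] at h1 h2 h3 h4 h5
  rcases hoff x hx with hx | hx | hx | hx | hx | hx
  · exact hxS hx
  all_goals linarith

/-- The Grassmann–Plücker relation among the determinants of five points. -/
lemma det_mul_det_add (a b c d e : Pt) :
    det a b c * det a d e - det a b d * det a c e + det a b e * det a c d = 0 := by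
  simp only [det]; ring

/-- A set of ordered triples of indices below `9`, stored as a bit mask. -/
abbrev TripleSet := ℕ

namespace TripleSet

/-- The bit representing the triple `(a, b, c)`. -/
def index (a b c : Fin 9) : ℕ := (9 * a + b) * 9 + c

lemma index_inj {a b c a' b' c' : Fin 9} :
    index a b c = index a' b' c' ↔ a = a' ∧ b = b' ∧ c = c' := by
  simp only [index, Fin.ext_iff]
  omega

/-- Membership of the triple `(a, b, c)`. -/
def mem (K : TripleSet) (a b c : Fin 9) : Bool := K.testBit (index a b c)

/-- Add the triple `(a, b, c)` and its rotations. -/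
def insert (K : TripleSet) (a b c : Fin 9) : TripleSet :=
  K ||| (2 ^ index a b c ||| 2 ^ index b c a ||| 2 ^ index c a b)

/-- Every triple of `K` is positively oriented in the configuration `f`. -/
def Holds (f : Fin 9 → Pt) (K : TripleSet) : Prop :=
  ∀ a b c, K.mem a b c → 0 < det (f a) (f b) (f c)

lemma holds_zero (f : Fin 9 → Pt) : Holds f 0 := by
  intro a b c h
  simp [mem] at h

lemma Holds.insert {f : Fin 9 → Pt} {K : TripleSet} (hK : Holds f K) {a b c : Fin 9}
    (h : 0 < det (f a) (f b) (f c)) : Holds f (K.insert a b c) := by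
  intro x y z hxyz
  simp only [mem, TripleSet.insert, Nat.testBit_or, Nat.testBit_two_pow, Bool.or_eq_true,
    decide_eq_true_eq, index_inj] at hxyz
  rcases hxyz with hxyz | (⟨rfl, rfl, rfl⟩ | ⟨rfl, rfl, rfl⟩) | ⟨rfl, rfl, rfl⟩
  · exact hK x y z hxyz
  · exact h
  · rwa [det_rotate]
  · rwa [← det_rotate]

/-- The triples in a list, together with their rotations. -/
def ofList (l : List (Fin 9 × Fin 9 × Fin 9)) : TripleSet :=
  l.foldr (fun t K => K.insert t.1 t.2.1 t.2.2) 0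

lemma holds_ofList {f : Fin 9 → Pt} {l : List (Fin 9 × Fin 9 × Fin 9)}
    (h : ∀ t ∈ l, 0 < det (f t.1) (f t.2.1) (f t.2.2)) : Holds f (ofList l) := by
  induction l with
  | nil => exact holds_zero f
  | cons t l ih =>
    rw [List.forall_mem_cons] at h
    exact (ih h.2).insert h.1

end TripleSet

/-- A refutation of a set of orientations of triples of nine points: a decision tree whose leaves
name a violated property of configurations without empty convex pentagons. -/
inductive Refutation
  /-- Branch on the orientation of `abc`: clockwise first, then counterclockwise. -/
  | split (a b c : Fin 9) (cw ccw : Refutation)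
  /-- `d` lies inside `abc`, although `abc` is oriented clockwise. -/
  | interior (a b c d : Fin 9)
  /-- The three terms of the Grassmann–Plücker relation are all positive. -/
  | plucker (a b c d e : Fin 9)
  /-- `abcde` is an empty convex pentagon. -/
  | pentagon (a b c d e : Fin 9)

namespace Refutation

/-- Whether `t` refutes the orientations in `K`. -/
def check : Refutation → TripleSet → Bool
  | split a b c cw ccw, K =>
    a != b && a != c && b != c && cw.check (K.insert a c b) && ccw.check (K.insert a b c)
  | interior a b c d, K => K.mem a b d && K.mem b c d && K.mem c a d && K.mem a c b
  | plucker a b c d e, K =>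
    (K.mem a b c && K.mem a d e || K.mem a c b && K.mem a e d) &&
    (K.mem a b d && K.mem a e c || K.mem a d b && K.mem a c e) &&
    (K.mem a b e && K.mem a c d || K.mem a e b && K.mem a d c)
  | pentagon a b c d e, K =>
    K.mem a b c && K.mem a b d && K.mem a b e && K.mem a c d && K.mem a c e &&
    K.mem a d e && K.mem b c d && K.mem b c e && K.mem b d e && K.mem c d e &&
    [0, 1, 2, 3, 4, 5, 6, 7, 8].all fun x =>
      x == a || x == b || x == c || x == d || x == e ||
      K.mem b a x || K.mem c b x || K.mem d c x || K.mem e d x || K.mem a e x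

theorem not_holds {f : Fin 9 → Pt}
    (hgp : ∀ a b c, a ≠ b → a ≠ c → b ≠ c → det (f a) (f b) (f c) ≠ 0)
    (hpent : ∀ a b c d e, CcwPentagon (f a) (f b) (f c) (f d) (f e) →
      ¬ ∀ x, OffPentagon (f a) (f b) (f c) (f d) (f e) (f x))
    (t : Refutation) {K : TripleSet} (hcheck : t.check K = true) : ¬ K.Holds f := by
  induction t generalizing K with
  | split a b c cw ccw ihcw ihccw =>
    intro hK
    simp only [check, Bool.and_eq_true, bne_iff_ne] at hcheck
    obtain ⟨⟨⟨⟨hab, hac⟩, hbc⟩, h1⟩, h2⟩ := hcheck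
    rcases (hgp a b c hab hac hbc).lt_or_gt with h | h
    · exact ihcw h1 (hK.insert (by rw [det_swap]; linarith))
    · exact ihccw h2 (hK.insert h)
  | interior a b c d =>
    intro hK
    simp only [check, Bool.and_eq_true] at hcheck
    obtain ⟨⟨⟨h1, h2⟩, h3⟩, h4⟩ := hcheck
    have := hK _ _ _ h1
    have := hK _ _ _ h2
    have := hK _ _ _ h3
    have := hK _ _ _ h4
    simp only [det] at *
    linarith
  | plucker a b c d e =>
    intro hK
    simp only [check, Bool.and_eq_true, Bool.or_eq_true] at hcheck
    obtain ⟨⟨h1, h2⟩, h3⟩ := hcheck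
    have mul_pos' : ∀ p q r s t : Fin 9, (K.mem p q r = true ∧ K.mem p s t = true) ∨
        (K.mem p r q = true ∧ K.mem p t s = true) →
        0 < det (f p) (f q) (f r) * det (f p) (f s) (f t) := by
      rintro p q r s t (⟨h, h'⟩ | ⟨h, h'⟩)
      · exact mul_pos (hK _ _ _ h) (hK _ _ _ h')
      · rw [← neg_mul_neg, ← det_swap, ← det_swap]
        exact mul_pos (hK _ _ _ h) (hK _ _ _ h')
    have k1 := mul_pos' _ _ _ _ _ h1
    have k2 := mul_pos' _ _ _ _ _ h2
    have k3 := mul_pos' _ _ _ _ _ h3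
    rw [det_swap (f a) (f c) (f e)] at k2
    linarith [det_mul_det_add (f a) (f b) (f c) (f d) (f e)]
  | pentagon a b c d e =>
    intro hK
    simp only [check, Bool.and_eq_true, and_assoc] at hcheck
    obtain ⟨h1, h2, h3, h4, h5, h6, h7, h8, h9, h10, hoff⟩ := hcheck
    refine hpent a b c d e ⟨hK _ _ _ h1, hK _ _ _ h2, hK _ _ _ h3, hK _ _ _ h4, hK _ _ _ h5,
      hK _ _ _ h6, hK _ _ _ h7, hK _ _ _ h8, hK _ _ _ h9, hK _ _ _ h10⟩ fun x => ?_
    rw [List.all_eq_true] at hoff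
    have hx := hoff x (by fin_cases x <;> simp)
    simp only [Bool.or_eq_true, beq_iff_eq, or_assoc] at hx
    rcases hx with rfl | rfl | rfl | rfl | rfl | h | h | h | h | h
    iterate 5 exact .inl (by simp)
    · exact .inr (.inl (hK _ _ _ h))
    · exact .inr (.inr (.inl (hK _ _ _ h)))
    · exact .inr (.inr (.inr (.inl (hK _ _ _ h))))
    · exact .inr (.inr (.inr (.inr (.inl (hK _ _ _ h)))))
    · exact .inr (.inr (.inr (.inr (.inr (hK _ _ _ h)))))

end Refutation

/-- Orientations of nine points in two nested counterclockwise quadrilaterals `0123` and `4567`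
around the point `8`, where `8` lies in the cone spanned by the vertices `0` and `1` (and `4` and
`5`) seen from the intersection point of the diagonals. -/
def nestedQuads : List (Fin 9 × Fin 9 × Fin 9) :=
  [(0, 1, 2), (1, 2, 3), (2, 3, 0), (3, 0, 1), (0, 8, 2), (1, 3, 8),
    (4, 5, 6), (5, 6, 7), (6, 7, 4), (7, 4, 5), (4, 8, 6), (5, 7, 8),
    (4, 5, 8), (5, 6, 8), (6, 7, 8), (7, 4, 8),
    (0, 1, 4), (0, 1, 5), (0, 1, 6), (0, 1, 7), (0, 1, 8),
    (1, 2, 4), (1, 2, 5), (1, 2, 6), (1, 2, 7), (1, 2, 8),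
    (2, 3, 4), (2, 3, 5), (2, 3, 6), (2, 3, 7), (2, 3, 8),
    (3, 0, 4), (3, 0, 5), (3, 0, 6), (3, 0, 7), (3, 0, 8)]

open Refutation in
/-- A refutation of `nestedQuads`, found by a backtracking search. -/
def refutation : Refutation :=
  split 1 3 5 (split 1 5 8 (plucker 1 0 3 5 8) (split 3 8 5 (plucker 3 0 1 5 8) (split 1 4 8
    (split 1 3 4 (plucker 1 0 3 4 8) (split 1 5 4 (plucker 1 0 3 5 4) (split 3 4 5 (plucker 3 0 1
    5 4) (split 3 4 8 (pentagon 1 5 3 8 4) (split 0 4 8 (split 0 5 4 (plucker 4 0 1 5 8) (split 0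
    5 8 (plucker 5 0 1 8 4) (pentagon 0 1 5 8 4))) (split 3 7 8 (split 3 4 7 (plucker 3 0 4 8 7)
    (split 0 4 7 (plucker 4 0 3 7 8) (split 0 8 7 (plucker 7 0 3 8 4) (pentagon 0 4 8 7 3))))
    (split 1 3 7 (plucker 3 0 1 7 8) (split 3 7 5 (plucker 3 0 5 7 8) (split 1 5 7 (plucker 5 1 3
    4 7) (split 2 5 8 (split 2 7 5 (plucker 5 1 2 7 8) (split 2 7 8 (plucker 7 2 3 8 5) (split 3 6
    8 (split 3 4 6 (plucker 3 0 4 8 6) (split 3 7 6 (plucker 3 0 6 7 8) (split 0 4 6 (plucker 4 0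
    3 6 8) (split 0 8 6 (plucker 6 0 3 8 4) (split 1 6 7 (plucker 7 1 3 5 6) (split 1 6 8 (plucker
    8 0 1 6 3) (split 0 4 7 (pentagon 0 4 8 6 3) (split 2 6 5 (pentagon 2 3 7 8 5) (split 3 4 7
    (pentagon 3 7 4 8 6) (split 3 6 5 (pentagon 3 7 8 5 6) (split 1 5 6 (plucker 5 1 2 3 6) (split
    1 8 7 (pentagon 1 5 6 7 8) (split 0 7 8 (split 2 6 8 (split 2 7 6 (plucker 2 1 6 8 7)
    (pentagon 2 3 7 8 6)) (split 0 7 6 (pentagon 0 4 8 6 7) (split 2 7 6 (pentagon 2 6 7 8 5)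
    (split 0 6 2 (plucker 6 0 1 2 7) (split 0 7 2 (plucker 7 0 1 6 2) (pentagon 0 7 6 2 3))))))
    (split 0 7 2 (plucker 0 1 2 7 8) (split 0 7 6 (plucker 0 1 6 7 8) (split 2 6 8 (pentagon 0 7 8
    2 3) (pentagon 0 7 8 6 3))))))))))))))))) (split 1 3 6 (plucker 3 0 1 6 8) (split 3 6 5
    (plucker 3 0 5 6 8) (split 1 5 6 (plucker 5 1 3 4 6) (split 2 6 5 (plucker 5 2 3 6 7) (split 2
    6 8 (plucker 6 2 3 8 5) (split 1 8 6 (pentagon 1 5 3 6 8) (pentagon 2 3 6 8 5)))))))))) (split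
    2 5 4 (plucker 5 1 2 8 4) (split 0 8 5 (plucker 8 0 1 2 5) (split 2 8 4 (plucker 8 0 2 5 4)
    (pentagon 1 2 5 8 4)))))))))))))) (split 3 8 4 (plucker 8 1 3 4 5) (split 1 8 6 (plucker 8 1 4
    5 6) (split 1 8 7 (plucker 8 1 4 5 7) (split 3 6 8 (plucker 8 3 4 6 5) (split 3 7 8 (plucker 8
    3 4 7 5) (split 1 3 6 (interior 1 3 6 8) (split 1 3 7 (interior 1 3 7 8) (split 3 6 4
    (interior 3 4 8 6) (split 1 4 6 (plucker 1 0 4 6 8) (split 1 4 7 (plucker 1 0 4 7 8) (split 3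
    6 5 (plucker 3 0 1 5 6) (split 3 7 5 (plucker 3 0 1 5 7) (split 1 7 6 (pentagon 1 4 8 6 7)
    (split 3 7 6 (pentagon 3 6 7 8 5) (split 0 6 7 (plucker 6 0 1 3 7) (split 0 6 4 (plucker 6 0 1
    7 4) (plucker 6 0 3 4 7)))))))))))))))))))) (split 1 3 7 (split 1 7 5 (plucker 1 0 3 7 5)
    (split 1 7 8 (plucker 1 0 3 7 8) (split 3 5 7 (plucker 3 0 1 7 5) (split 3 8 7 (plucker 3 0 1
    7 8) (split 1 5 6 (split 3 5 6 (plucker 5 1 3 6 7) (split 1 4 8 (split 1 7 4 (interior 1 4 8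
    7) (split 1 3 4 (plucker 1 0 3 4 8) (split 3 4 7 (plucker 3 0 1 7 4) (split 3 4 8 (plucker 4 1
    3 8 7) (split 1 6 4 (plucker 4 1 6 7 8) (split 3 4 6 (plucker 4 3 6 8 7) (split 1 6 8 (plucker
    6 1 4 5 8) (split 3 8 6 (plucker 6 3 4 8 5) (split 3 7 6 (pentagon 3 4 8 6 7) (split 1 6 3
    (plucker 3 0 1 7 6) (split 1 6 7 (plucker 6 1 3 4 7) (split 1 5 8 (pentagon 1 6 7 8 5) (split
    1 5 4 (plucker 1 0 4 8 5) (split 0 4 8 (split 0 5 4 (plucker 4 0 1 5 8) (split 0 5 8 (plucker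
    5 0 1 8 4) (pentagon 0 1 5 8 4))) (split 0 4 7 (plucker 4 0 1 8 7) (split 0 8 7 (plucker 7 0 1
    4 8) (pentagon 0 4 8 7 3))))))))))))))))) (split 1 8 5 (plucker 8 1 4 5 7) (split 1 4 5
    (interior 1 4 5 8) (split 1 6 7 (split 3 6 7 (plucker 7 1 3 6 5) (split 3 4 8 (split 3 5 8
    (plucker 8 1 3 4 5) (split 3 5 4 (plucker 3 0 4 5 8) (split 0 5 8 (split 0 6 5 (plucker 5 0 1
    6 8) (split 0 7 5 (plucker 5 0 1 7 8) (split 0 7 8 (plucker 7 0 1 8 5) (split 2 8 7 (plucker 8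
    0 1 2 7) (split 2 5 8 (plucker 8 0 1 5 2) (split 2 5 7 (interior 2 5 7 8) (split 2 5 6
    (plucker 5 1 2 6 7) (split 2 4 6 (split 2 5 4 (plucker 2 1 4 6 5) (split 1 4 6 (plucker 4 1 2
    5 6) (split 2 8 4 (plucker 4 1 2 8 6) (pentagon 2 3 5 8 4)))) (split 2 8 6 (plucker 6 2 4 8 5)
    (split 0 6 8 (plucker 8 0 2 6 5) (split 0 7 6 (pentagon 0 6 7 8 5) (split 0 6 2 (interior 0 2
    8 6) (split 2 6 7 (plucker 6 0 1 2 7) (split 2 4 7 (plucker 2 1 4 7 6) (split 2 8 4 (pentagon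
    2 4 8 6 7) (split 2 5 4 (plucker 2 1 4 8 5) (pentagon 2 3 5 8 4))))))))))))))))) (split 0 5 4
    (plucker 5 0 1 8 4) (split 0 8 4 (plucker 8 0 1 4 5) (pentagon 0 5 8 4 3)))))) (split 1 3 4
    (plucker 3 0 1 4 8) (split 3 4 7 (plucker 3 0 1 7 4) (split 3 4 6 (plucker 4 3 6 8 7) (split 3
    8 6 (plucker 6 3 4 7 8) (split 1 7 4 (plucker 7 1 3 5 4) (split 1 6 8 (pentagon 1 7 3 4 8)
    (pentagon 3 4 8 6 7))))))))) (split 1 6 8 (plucker 1 0 6 8 7) (pentagon 1 6 7 8 5)))))))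
    (split 1 3 6 (plucker 1 0 3 6 5) (split 1 7 6 (plucker 1 0 3 7 6) (split 1 4 5 (plucker 5 1 4
    7 6) (split 1 8 5 (plucker 5 1 4 7 8) (split 1 4 6 (plucker 6 1 4 5 7) (split 1 8 6 (plucker 6
    1 4 8 5) (pentagon 1 7 8 5 6)))))))))))) (split 1 3 6 (split 1 6 5 (plucker 1 0 3 6 5) (split
    1 6 7 (plucker 1 0 3 6 7) (split 1 6 8 (plucker 1 0 3 6 8) (split 3 5 6 (plucker 3 0 1 6 5)
    (split 3 7 6 (plucker 3 0 1 6 7) (split 3 8 6 (plucker 3 0 1 6 8) (split 1 6 4 (plucker 6 1 4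
    7 5) (split 3 4 6 (plucker 6 3 4 5 7) (split 3 7 8 (split 1 7 8 (plucker 7 1 3 8 6) (split 1 7
    4 (plucker 7 1 4 8 6) (split 3 4 7 (plucker 7 3 4 6 8) (split 1 8 4 (pentagon 1 6 7 4 8)
    (split 1 3 4 (interior 1 3 4 7) (split 3 4 8 (plucker 4 1 3 8 6) (split 1 5 8 (split 1 7 5
    (plucker 1 0 5 8 7) (pentagon 1 6 7 8 5)) (split 1 5 4 (plucker 1 0 4 8 5) (split 0 4 5 (split
    0 5 8 (plucker 5 0 1 8 4) (split 0 4 8 (pentagon 0 1 5 8 4) (split 0 4 7 (plucker 4 0 1 8 7)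
    (split 0 8 7 (plucker 7 0 1 4 8) (pentagon 0 4 8 7 3))))) (split 0 4 7 (plucker 4 0 1 5 7)
    (split 0 4 8 (plucker 4 0 1 5 8) (split 0 8 7 (plucker 7 0 1 4 8) (pentagon 0 4 8 7
    3))))))))))))) (split 3 7 5 (plucker 7 3 5 8 6) (split 3 4 8 (plucker 8 3 4 7 6) (split 3 8 5
    (plucker 8 3 5 6 7) (split 1 5 8 (pentagon 1 6 3 8 5) (split 3 4 7 (pentagon 3 7 4 8 6)
    (pentagon 3 7 8 5 6))))))))))))))) (split 1 3 4 (split 1 4 5 (plucker 1 0 3 4 5) (split 1 4 6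
    (plucker 1 0 3 4 6) (split 1 4 7 (plucker 1 0 3 4 7) (split 1 4 8 (plucker 1 0 3 4 8) (split 3
    5 4 (plucker 3 0 1 4 5) (split 3 6 4 (plucker 3 0 1 4 6) (split 3 7 4 (plucker 3 0 1 4 7)
    (split 3 8 4 (plucker 3 0 1 4 8) (split 3 6 8 (split 3 5 6 (plucker 6 3 4 5 8) (split 3 6 7
    (plucker 6 3 4 8 7) (split 3 5 8 (plucker 8 3 4 6 5) (split 3 8 7 (plucker 8 3 4 7 6) (split 1
    7 6 (pentagon 1 4 3 6 7) (pentagon 3 8 6 7 4)))))) (split 1 8 6 (plucker 6 1 3 4 8) (split 1 5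
    8 (split 3 5 8 (plucker 5 1 3 8 4) (split 2 4 8 (split 2 5 4 (plucker 4 1 2 5 8) (split 2 5 8
    (plucker 5 1 2 8 4) (pentagon 2 3 5 8 4))) (split 2 4 6 (plucker 4 1 2 8 6) (split 2 4 7
    (plucker 4 1 2 8 7) (split 2 8 6 (plucker 6 1 2 4 8) (split 0 8 4 (plucker 8 0 1 2 4) (split 0
    6 8 (plucker 8 0 1 6 2) (split 1 7 6 (pentagon 1 2 4 8 6) (split 0 6 2 (interior 0 2 8 6)
    (split 0 6 4 (interior 0 4 8 6) (split 0 7 4 (plucker 4 0 1 6 7) (split 0 5 8 (split 0 6 5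
    (plucker 0 1 5 6 8) (split 0 7 5 (plucker 5 0 6 7 8) (split 0 7 8 (plucker 7 0 4 5 8) (split 2
    8 7 (plucker 8 0 2 4 7) (split 2 7 6 (pentagon 2 4 8 6 7) (split 0 7 6 (pentagon 0 6 7 8 5)
    (plucker 6 0 1 2 7))))))) (split 0 5 4 (plucker 0 1 4 5 8) (pentagon 0 5 8 4 3))))))))))))))
    (split 1 5 7 (plucker 5 1 4 7 8) (split 1 8 7 (plucker 7 1 4 8 5) (split 3 8 5 (pentagon 1 4 3
    5 8) (split 3 7 8 (pentagon 1 4 3 8 7) (split 1 7 6 (pentagon 1 4 8 6 7) (split 3 6 5 (plucker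
    3 0 5 6 8) (split 3 7 5 (plucker 3 0 5 7 8) (split 3 6 7 (plucker 6 1 3 7 4) (pentagon 3 6 7 8
    5)))))))))))))))))))) (split 0 2 4 (split 0 2 5 (split 0 2 7 (split 0 2 6 (split 0 7 8 (split
    0 4 8 (split 0 5 8 (plucker 8 0 4 7 5) (split 0 5 7 (interior 0 5 7 8) (split 0 5 4 (plucker 0
    1 4 5 8) (split 1 5 8 (split 1 7 5 (plucker 5 0 1 7 8) (split 1 7 8 (plucker 7 0 1 8 5) (split
    3 4 8 (split 3 5 4 (plucker 4 0 3 8 5) (split 3 5 8 (plucker 5 0 3 4 8) (split 2 4 8 (pentagon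
    0 8 4 2 3) (pentagon 0 5 8 4 3)))) (split 2 4 8 (plucker 4 0 2 3 8) (split 2 7 8 (split 2 4 7
    (plucker 2 0 4 8 7) (split 3 4 7 (plucker 4 2 3 8 7) (split 3 8 7 (plucker 7 0 2 3 8)
    (pentagon 2 3 4 8 7)))) (split 2 7 5 (plucker 7 0 2 5 8) (split 1 6 7 (split 0 6 7 (plucker 7
    0 1 5 6) (split 2 7 6 (plucker 7 0 2 6 5) (split 3 6 7 (pentagon 1 2 3 7 6) (split 3 8 7
    (pentagon 1 2 3 7 8) (split 3 4 7 (plucker 3 0 4 8 7) (split 3 4 6 (plucker 4 3 6 8 7) (split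
    3 8 6 (plucker 6 3 4 7 8) (pentagon 3 4 8 6 7)))))))) (split 1 6 5 (plucker 1 0 5 7 6) (split
    1 6 8 (plucker 1 0 6 8 7) (pentagon 1 6 7 8 5)))))))))) (split 1 5 4 (plucker 5 0 1 8 4)
    (split 1 8 4 (plucker 8 0 1 4 5) (pentagon 0 1 5 8 4))))))) (split 0 4 7 (plucker 0 1 4 8 7)
    (split 0 4 6 (plucker 4 0 6 8 7) (split 0 8 6 (plucker 8 0 4 6 7) (split 0 7 6 (pentagon 0 4 8
    6 7) (split 2 6 7 (split 3 7 6 (plucker 6 0 2 3 7) (pentagon 0 7 6 2 3)) (split 2 6 4 (plucker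
    6 0 2 4 7) (split 2 6 8 (plucker 6 0 2 8 4) (split 2 7 4 (plucker 7 0 2 6 4) (split 2 7 8
    (plucker 7 0 2 6 8) (split 2 8 4 (pentagon 2 6 7 4 8) (split 2 5 8 (split 2 6 5 (plucker 2 0 5
    6 8) (split 2 7 5 (plucker 2 0 5 7 8) (pentagon 2 6 7 8 5))) (split 2 5 4 (plucker 2 0 4 5 8)
    (split 0 4 5 (plucker 4 0 2 6 5) (split 0 8 5 (plucker 5 0 2 4 8) (split 3 4 5 (split 3 6 4
    (plucker 4 0 3 6 5) (split 3 7 4 (plucker 4 0 3 7 5) (split 3 8 4 (plucker 4 0 3 8 5) (split 3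
    6 8 (plucker 6 0 3 8 4) (split 3 7 8 (plucker 7 0 3 8 4) (split 1 4 5 (pentagon 1 2 3 5 4)
    (split 1 4 8 (pentagon 1 2 3 8 4) (split 1 4 7 (plucker 4 0 1 5 7) (split 1 8 7 (plucker 7 0 1
    4 8) (pentagon 0 1 4 8 7)))))))))) (split 1 5 4 (plucker 4 0 1 5 3) (split 1 5 8 (plucker 5 0
    1 8 4) (split 1 4 8 (pentagon 1 2 5 8 4) (split 1 4 7 (plucker 4 0 1 8 7) (split 1 8 7
    (plucker 7 0 1 4 8) (pentagon 0 1 4 8 7)))))))))))))))))))))) (split 0 4 8 (split 0 7 4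
    (interior 0 4 8 7) (split 0 6 4 (plucker 4 0 6 7 8) (split 0 6 8 (plucker 8 0 4 7 6) (split 3
    4 8 (split 1 4 8 (plucker 4 0 1 3 8) (split 0 5 8 (split 0 6 5 (plucker 0 1 5 6 8) (split 0 7
    5 (plucker 0 1 5 7 8) (split 0 7 6 (pentagon 0 6 7 8 5) (split 2 7 8 (split 2 5 7 (plucker 7 0
    2 5 8) (split 2 6 7 (plucker 7 0 2 6 5) (split 2 5 8 (plucker 8 0 2 7 5) (split 1 4 5 (split 1
    5 8 (interior 1 4 5 8) (split 0 4 5 (plucker 4 0 1 5 8) (split 2 5 4 (plucker 5 0 2 4 7)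
    (split 3 4 5 (pentagon 1 2 3 5 4) (split 3 8 5 (pentagon 1 2 3 5 8) (pentagon 0 8 4 5 3))))))
    (split 3 5 4 (plucker 4 1 3 5 8) (split 2 4 8 (split 2 5 4 (plucker 2 0 4 5 8) (split 3 8 5
    (pentagon 2 3 5 8 4) (split 3 6 5 (plucker 5 0 3 8 6) (split 3 6 8 (plucker 6 0 3 5 8)
    (pentagon 0 6 8 5 3))))) (split 2 4 7 (plucker 2 0 4 8 7) (split 2 4 6 (plucker 4 0 2 6 8)
    (split 2 8 6 (plucker 6 0 2 8 4) (pentagon 2 4 8 6 7)))))))))) (split 1 8 7 (plucker 7 0 1 8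
    2) (split 3 7 8 (plucker 7 0 2 8 3) (split 1 8 6 (plucker 8 0 1 6 7) (split 2 6 8 (plucker 8 0
    2 7 6) (split 3 6 8 (plucker 8 0 3 7 6) (split 2 5 8 (pentagon 0 6 8 2 3) (split 1 4 6
    (plucker 1 0 4 6 8) (split 1 4 7 (plucker 1 0 4 7 8) (split 1 7 6 (pentagon 1 4 8 6 7) (split
    2 6 7 (plucker 6 0 1 2 7) (split 3 6 7 (plucker 6 0 1 3 7) (split 3 6 5 (pentagon 2 3 6 7 8)
    (split 2 5 6 (pentagon 0 6 5 2 3) (split 2 7 5 (pentagon 2 5 6 7 8) (plucker 2 0 5 6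
    7))))))))))))))))))) (split 0 5 4 (plucker 0 1 4 5 8) (split 3 5 4 (plucker 4 0 3 8 5) (split
    3 5 8 (plucker 5 0 3 4 8) (split 2 4 8 (pentagon 0 8 4 2 3) (pentagon 0 5 8 4 3))))))) (split
    2 4 8 (plucker 4 0 2 3 8) (split 2 4 6 (plucker 4 0 2 6 8) (split 2 4 7 (plucker 4 0 2 7 6)
    (split 3 4 6 (plucker 4 0 3 6 8) (split 3 4 7 (plucker 4 0 3 7 6) (split 2 8 7 (plucker 7 0 2
    8 4) (split 3 8 7 (plucker 7 0 3 8 4) (split 1 7 8 (pentagon 1 2 3 8 7) (pentagon 2 3 4 8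
    7))))))))))))) (split 0 8 5 (plucker 8 0 4 5 7) (split 0 4 5 (interior 0 4 5 8) (split 0 7 5
    (plucker 0 1 5 7 8) (split 3 5 8 (split 1 5 8 (plucker 5 0 1 3 8) (split 1 5 7 (plucker 5 0 1
    7 8) (split 3 7 5 (plucker 5 0 3 8 7) (split 1 8 7 (plucker 7 0 1 8 5) (split 3 7 8 (plucker 7
    0 3 5 8) (split 0 6 8 (split 0 4 6 (plucker 0 1 4 8 6) (split 0 7 6 (plucker 0 1 6 7 8) (split
    3 6 5 (pentagon 0 7 8 5 3) (split 0 4 7 (pentagon 0 7 4 8 6) (split 0 6 5 (pentagon 0 7 8 5 6)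
    (split 1 5 6 (plucker 5 0 1 3 6) (split 2 5 6 (pentagon 0 6 5 2 3) (split 2 5 7 (pentagon 0 7
    5 2 3) (split 2 5 8 (pentagon 0 8 5 2 3) (split 2 5 4 (plucker 5 0 2 4 6) (split 2 6 7
    (plucker 6 0 2 5 7) (split 2 6 8 (plucker 6 0 2 5 8) (split 2 8 4 (plucker 8 0 2 5 4) (split 1
    8 6 (pentagon 1 2 5 6 8) (split 2 8 7 (pentagon 2 5 6 7 8) (split 3 6 8 (plucker 6 0 1 3 8)
    (split 3 7 6 (pentagon 3 6 7 8 5) (split 1 6 7 (plucker 6 0 1 3 7) (split 1 4 6 (split 1 5 4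
    (plucker 1 0 4 6 5) (split 1 8 4 (plucker 1 0 4 6 8) (pentagon 1 2 5 8 4))) (split 1 4 7
    (plucker 1 0 4 7 6) (split 1 8 4 (pentagon 1 4 8 6 7) (split 1 5 4 (plucker 1 0 4 8 5)
    (pentagon 1 2 5 8 4))))))))))))))))))))))) (split 0 6 5 (plucker 0 1 5 6 8) (split 3 6 5
    (plucker 5 0 3 7 6) (split 3 6 8 (plucker 6 0 3 5 8) (split 2 5 8 (pentagon 0 8 5 2 3)
    (pentagon 0 6 8 5 3))))))))))) (split 2 5 8 (plucker 5 0 2 3 8) (split 2 5 4 (plucker 5 0 2 4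
    8) (split 3 5 4 (plucker 5 0 3 4 8) (split 2 8 4 (plucker 8 0 2 5 4) (split 3 8 4 (plucker 8 0
    3 5 4) (split 1 4 8 (pentagon 1 2 3 8 4) (pentagon 2 3 5 8 4))))))))))))) (split 0 4 6
    (plucker 0 1 2 6 4) (split 0 5 6 (plucker 0 1 2 6 5) (split 0 7 6 (plucker 0 1 2 6 7) (split 0
    8 6 (plucker 0 1 2 6 8) (split 2 6 4 (plucker 2 0 1 4 6) (split 2 6 5 (plucker 2 0 1 5 6)
    (split 2 6 7 (plucker 2 0 1 7 6) (split 2 6 8 (plucker 2 0 1 8 6) (split 0 7 8 (split 2 7 8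
    (plucker 7 0 2 6 8) (split 0 4 7 (plucker 7 0 4 6 8) (split 2 7 4 (plucker 7 2 4 8 6) (split 2
    8 4 (pentagon 2 6 7 4 8) (split 0 4 8 (plucker 4 0 2 6 8) (split 2 5 8 (split 2 7 5 (plucker 2
    0 5 7 8) (pentagon 2 6 7 8 5)) (split 2 5 4 (plucker 2 0 4 5 8) (split 0 4 5 (plucker 4 0 2 6
    5) (split 0 8 5 (plucker 5 0 2 4 8) (split 1 4 8 (split 1 5 4 (plucker 4 0 1 5 8) (split 1 5 8
    (plucker 5 0 1 8 4) (pentagon 1 2 5 8 4))) (split 1 4 7 (plucker 4 0 1 8 7) (split 1 8 7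
    (plucker 7 0 1 4 8) (pentagon 0 1 4 8 7))))))))))))) (split 0 7 5 (plucker 7 0 5 8 6) (split 0
    4 8 (plucker 8 0 4 7 6) (split 0 8 5 (plucker 8 0 5 6 7) (split 2 5 8 (pentagon 0 8 5 2 6)
    (split 0 4 7 (pentagon 0 7 4 8 6) (pentagon 0 7 8 5 6)))))))))))))))) (split 0 4 7 (plucker 0
    1 2 7 4) (split 0 5 7 (plucker 0 1 2 7 5) (split 0 8 7 (plucker 0 1 2 7 8) (split 2 7 4
    (plucker 2 0 1 4 7) (split 2 7 5 (plucker 2 0 1 5 7) (split 2 7 8 (plucker 2 0 1 8 7) (split 2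
    6 8 (split 0 6 2 (plucker 2 0 1 8 6) (split 2 7 6 (plucker 2 0 3 7 6) (split 2 4 6 (plucker 6
    2 4 8 7) (split 2 4 8 (plucker 8 2 4 7 6) (pentagon 2 7 4 8 6))))) (split 0 8 6 (plucker 8 0 2
    7 6) (split 2 5 6 (split 0 5 6 (plucker 5 0 2 7 6) (split 0 4 8 (split 2 4 8 (plucker 4 0 2 7
    8) (split 0 5 4 (plucker 4 0 5 7 8) (split 2 4 5 (plucker 4 2 5 8 7) (split 0 5 8 (plucker 5 0
    4 8 6) (split 2 8 5 (plucker 5 2 4 6 8) (split 2 7 6 (pentagon 2 6 7 8 5) (split 1 5 6 (split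
    1 6 8 (plucker 6 0 1 8 5) (split 1 5 8 (pentagon 1 2 6 8 5) (split 1 5 4 (plucker 5 0 1 8 4)
    (split 1 8 4 (plucker 8 0 1 4 5) (pentagon 0 1 5 8 4))))) (split 1 5 4 (plucker 5 0 1 6 4)
    (split 1 5 8 (plucker 5 0 1 6 8) (split 1 8 4 (plucker 8 0 1 4 5) (pentagon 0 1 5 8
    4))))))))))) (split 0 4 6 (plucker 0 1 4 8 6) (split 0 7 6 (pentagon 0 4 8 6 7) (split 0 2 6
    (plucker 0 1 2 7 6) (split 2 6 4 (plucker 2 0 1 4 6) (split 2 6 7 (plucker 6 0 2 7 4) (split 2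
    8 4 (pentagon 0 4 8 2 7) (split 2 5 8 (pentagon 2 6 7 8 5) (split 2 5 4 (plucker 2 0 4 5 8)
    (split 0 4 5 (plucker 4 0 2 6 5) (split 0 8 5 (plucker 5 0 2 4 8) (split 1 4 5 (split 1 5 8
    (plucker 5 0 1 8 4) (split 1 4 8 (pentagon 1 2 5 8 4) (split 1 4 7 (plucker 4 0 1 8 7) (split
    1 8 7 (plucker 7 0 1 4 8) (pentagon 0 1 4 8 7))))) (split 1 4 7 (plucker 4 0 1 5 7) (split 1 4
    8 (plucker 4 0 1 5 8) (split 1 8 7 (plucker 7 0 1 4 8) (pentagon 0 1 4 8 7)))))))))))))))))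
    (split 0 6 2 (plucker 2 0 1 5 6) (split 2 5 8 (plucker 2 0 5 6 8) (split 2 4 5 (plucker 5 2 4
    7 6) (plucker 5 2 4 7 8)))))))))))))) (split 0 4 5 (plucker 0 1 2 5 4) (split 0 8 5 (plucker 0
    1 2 5 8) (split 2 5 4 (plucker 2 0 1 4 5) (split 2 5 8 (plucker 2 0 1 8 5) (split 0 4 8 (split
    0 6 4 (plucker 4 0 5 6 8) (split 0 7 4 (plucker 4 0 5 7 6) (split 0 6 8 (plucker 8 0 4 6 5)
    (split 0 7 8 (plucker 8 0 4 7 5) (split 2 4 8 (pentagon 0 8 4 2 5) (split 0 6 2 (plucker 0 1 2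
    6 4) (split 0 7 2 (plucker 0 1 2 7 4) (split 0 6 5 (plucker 0 1 4 5 6) (split 0 7 5 (plucker 0
    1 4 5 7) (split 2 4 6 (plucker 4 0 2 6 8) (split 2 4 7 (plucker 4 0 2 7 6) (split 2 8 6
    (plucker 6 0 2 8 4) (split 2 8 7 (plucker 7 0 2 8 4) (split 2 7 6 (pentagon 2 4 8 6 7) (split
    0 7 6 (pentagon 0 6 7 8 5) (plucker 6 0 2 4 7)))))))))))))))) (split 2 8 4 (plucker 4 0 2 8 5)
    (split 3 4 5 (split 3 8 4 (plucker 4 0 3 8 5) (split 1 4 5 (pentagon 1 2 3 5 4) (split 1 4 8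
    (pentagon 1 2 3 8 4) (split 3 8 5 (pentagon 2 3 5 8 4) (split 1 5 8 (plucker 5 0 1 3 8) (split
    1 5 6 (plucker 5 1 4 6 8) (split 1 5 7 (plucker 5 1 4 7 8) (split 3 6 5 (plucker 5 3 4 8 6)
    (split 3 7 5 (plucker 5 3 4 8 7) (split 1 8 6 (plucker 8 1 4 5 6) (split 1 8 7 (plucker 8 1 4
    5 7) (split 3 6 8 (plucker 8 3 4 6 5) (split 3 7 8 (plucker 8 3 4 7 5) (split 3 7 6 (pentagon
    3 6 7 8 5) (split 3 6 4 (interior 3 4 5 6) (split 1 4 6 (plucker 1 0 4 6 5) (split 1 4 7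
    (plucker 1 0 4 7 5) (split 1 6 7 (plucker 6 1 3 7 4) (pentagon 1 4 8 6 7)))))))))))))))))))
    (split 1 5 4 (plucker 4 0 1 5 3) (split 1 5 8 (plucker 5 0 1 8 4) (split 3 8 5 (plucker 5 0 3
    4 8) (split 1 4 8 (pentagon 1 2 5 8 4) (split 3 8 4 (plucker 4 0 1 8 3) (split 1 4 6 (plucker
    4 1 5 8 6) (split 1 4 7 (plucker 4 1 5 8 7) (split 3 6 4 (plucker 4 3 5 6 8) (split 3 7 4
    (plucker 4 3 5 7 6) (split 1 8 6 (plucker 8 1 4 5 6) (split 1 8 7 (plucker 8 1 4 5 7) (split 3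
    6 8 (plucker 8 3 4 6 5) (split 3 7 8 (plucker 8 3 4 7 5) (split 1 7 6 (pentagon 1 4 8 6 7)
    (split 3 6 5 (plucker 3 0 4 5 6) (split 3 7 5 (plucker 3 0 4 5 7) (split 3 6 7 (plucker 6 1 3
    7 4) (pentagon 3 6 7 8 5)))))))))))))))))))))))))) (split 0 8 4 (plucker 0 1 2 4 8) (split 2 4
    8 (plucker 2 0 1 8 4) (split 0 5 8 (split 2 5 8 (plucker 8 0 2 5 4) (split 0 6 8 (plucker 8 0
    4 6 5) (split 0 7 8 (plucker 8 0 4 7 5) (split 2 8 6 (plucker 8 2 4 5 6) (split 2 8 7 (plucker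
    8 2 4 5 7) (split 0 6 2 (interior 0 2 8 6) (split 0 7 2 (interior 0 2 8 7) (split 0 6 4
    (interior 0 4 8 6) (split 0 6 5 (plucker 0 1 5 6 8) (split 0 7 5 (plucker 0 1 5 7 8) (split 2
    4 6 (plucker 2 0 1 6 4) (split 2 4 7 (plucker 2 0 1 7 4) (split 2 7 6 (pentagon 2 4 8 6 7)
    (split 0 7 6 (pentagon 0 6 7 8 5) (plucker 6 0 2 4 7))))))))))))))) (split 0 5 2 (plucker 0 1
    2 5 8) (split 0 5 4 (plucker 0 1 4 5 8) (split 2 4 5 (plucker 2 0 1 5 4) (split 2 8 5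
    (pentagon 0 5 8 2 4) (split 3 4 8 (split 3 5 4 (plucker 4 0 3 8 5) (split 3 5 8 (plucker 5 0 3
    4 8) (pentagon 0 5 8 4 3))) (split 2 7 8 (split 0 7 2 (plucker 2 0 1 8 7) (split 2 4 7
    (plucker 2 0 3 4 7) (split 0 7 4 (plucker 4 0 2 5 7) (split 3 4 7 (plucker 4 0 3 7 8) (split 3
    8 7 (plucker 7 2 3 4 8) (split 1 7 8 (pentagon 1 2 3 8 7) (pentagon 2 3 4 8 7))))))) (split 2
    7 5 (plucker 2 1 5 8 7) (split 0 5 7 (plucker 5 0 2 4 7) (split 0 8 7 (plucker 8 0 2 4 7)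
    (split 1 4 5 (split 1 8 4 (plucker 4 0 1 5 8) (split 1 8 5 (pentagon 0 1 5 8 4) (split 1 7 5
    (plucker 5 0 1 7 8) (split 1 6 5 (plucker 5 1 4 7 6) (split 1 7 8 (plucker 7 0 1 8 5) (split 1
    6 8 (plucker 8 1 4 6 5) (split 2 7 6 (pentagon 1 2 7 8 5) (split 1 7 6 (pentagon 1 6 7 8 5)
    (split 1 6 4 (interior 1 4 5 6) (split 1 7 4 (interior 1 4 5 7) (split 3 6 7 (pentagon 1 2 3 7
    6) (split 3 8 7 (pentagon 1 2 3 7 8) (split 3 4 7 (plucker 3 0 4 8 7) (split 3 4 6 (plucker 4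
    1 3 6 7) (split 3 8 6 (plucker 6 1 3 7 8) (pentagon 3 4 8 6 7)))))))))))))))) (split 1 7 5
    (plucker 5 0 1 7 4) (split 1 8 5 (plucker 5 0 1 8 4) (split 1 7 8 (plucker 7 0 1 8 5) (split 1
    6 8 (split 1 7 6 (plucker 1 0 6 8 7) (split 2 7 6 (plucker 7 1 2 5 6) (split 0 6 8 (plucker 8
    0 1 5 6) (split 2 8 6 (plucker 8 0 2 4 6) (pentagon 1 2 7 8 6))))) (split 1 6 5 (plucker 1 0 5
    8 6) (split 2 7 6 (pentagon 1 2 7 8 5) (split 1 7 6 (pentagon 1 6 7 8 5) (split 3 6 7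
    (pentagon 1 2 3 7 6) (split 3 8 7 (pentagon 1 2 3 7 8) (split 3 4 7 (plucker 3 0 4 8 7) (split
    3 4 6 (plucker 4 3 6 8 7) (split 3 8 6 (plucker 6 1 3 7 8) (pentagon 3 4 8 6
    7))))))))))))))))))))))))))))))

lemma refutation_check : refutation.check (.ofList nestedQuads) = true := by
  decide +kernel

lemma CcwQuad.det_nonneg_of_mem_convexHull {a b c d x : Pt} (h : CcwQuad a b c d)
    (hx : x ∈ convexHull ℝ (({a, b, c, d} : Finset Pt) : Set Pt)) :
    0 ≤ det a b x ∧ 0 ≤ det b c x ∧ 0 ≤ det c d x ∧ 0 ≤ det d a x := by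
  obtain ⟨h1, h2, h3, h4⟩ := h
  refine ⟨?_, ?_, ?_, ?_⟩ <;>
  · refine _root_.det_nonneg_of_mem_convexHull (fun y hy => ?_) hx
    simp only [Finset.mem_coe, Finset.mem_insert, Finset.mem_singleton] at hy
    simp only [det] at *
    rcases hy with rfl | rfl | rfl | rfl <;> linarith

/-- Any 9-point set in general position with convex layer type (4,4,1) contains
an empty convex pentagon. -/
theorem stmt7 (P : Finset Pt) (hcard : P.card = 9) (hgp : GenPos P)
    (h1 : (hullVerts P).card = 4)
    (h2 : (hullVerts (P \ hullVerts P)).card = 4) :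
    ∃ S, EmptyConvexPentagon P S := by
  by_contra! hno
  set H := hullVerts P with hH
  set Q := hullVerts (P \ H) with hQ
  have hHP : H ⊆ P := Finset.filter_subset _ _
  have hQP : Q ⊆ P \ H := Finset.filter_subset _ _
  obtain ⟨e, he⟩ : ∃ e, (P \ H) \ Q = {e} := by
    rw [← Finset.card_eq_one, Finset.card_sdiff_of_subset hQP, Finset.card_sdiff_of_subset hHP]
    omega
  have heP : e ∈ (P \ H) \ Q := by simp [he]
  simp only [Finset.mem_sdiff] at heP
  obtain ⟨⟨heP, heH⟩, heQ⟩ := heP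
  have hP : P = H ∪ Q ∪ {e} := by
    rw [← he, Finset.union_assoc, Finset.union_sdiff_of_subset hQP,
      Finset.union_sdiff_of_subset hHP]
  have hgp' : ∀ {S}, S ⊆ P → GenPos (insert e S) := fun hS p hp q hq r hr =>
    have h := Finset.insert_subset heP hS
    hgp p (h hp) q (h hq) r (h hr)
  have houter : ∀ x ∈ P, x ∈ convexHull ℝ (H : Set Pt) :=
    fun x hx => subset_convexHull_hullVerts P hx
  have hinner : e ∈ convexHull ℝ (Q : Set Pt) :=
    subset_convexHull_hullVerts (P \ H) (by simp [heP, heH])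
  obtain ⟨a₀, a₁, a₂, a₃, hHa, ha, ha₁, ha₂⟩ :=
    exists_ccwQuad_insert h1 (convexPos_hullVerts _) heH (hgp' hHP)
  obtain ⟨b₀, b₁, b₂, b₃, hQb, hb, hb₁, hb₂⟩ :=
    exists_ccwQuad_insert h2 (convexPos_hullVerts _) heQ (hgp' (hQP.trans Finset.sdiff_subset))
  rw [hHa] at houter
  rw [hQb] at hinner
  let f : Fin 9 → Pt := ![a₀, a₁, a₂, a₃, b₀, b₁, b₂, b₃, e]
  have hfP : Finset.univ.image f = P := by
    rw [hP, hHa, hQb]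
    ext x
    simp [f, Fin.exists_fin_succ, eq_comm]
    tauto
  have hfmem : ∀ i, f i ∈ P := fun i => hfP ▸ Finset.mem_image_of_mem f (Finset.mem_univ i)
  have hf : Function.Injective f := by
    rw [← Set.injOn_univ, ← Finset.coe_univ, ← Finset.card_image_iff, hfP, hcard]
    simp
  have hdet : ∀ i j k, i ≠ j → i ≠ k → j ≠ k → det (f i) (f j) (f k) ≠ 0 :=
    fun i j k hij hik hjk => hgp.det_ne_zero (hfmem i) (hfmem j) (hfmem k) (hf.ne hij)
      (hf.ne hik) (hf.ne hjk)
  refine refutation.not_holds (f := f) hdet ?_ refutation_check (TripleSet.holds_ofList ?_)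
  · intro a b c d e h hoff
    refine hno _ (h.emptyConvexPentagon ?_ ?_)
    · simp [Finset.insert_subset_iff, hfmem]
    · rw [← hfP]
      simpa using hoff
  · have hpos : ∀ {i j k}, i ≠ j → i ≠ k → j ≠ k → 0 ≤ det (f i) (f j) (f k) →
        0 < det (f i) (f j) (f k) :=
      fun hij hik hjk h => lt_of_le_of_ne h (hdet _ _ _ hij hik hjk).symm
    have hin := hb.det_nonneg_of_mem_convexHull hinner
    have hout := fun i => ha.det_nonneg_of_mem_convexHull (houter (f i) (hfmem i))
    simp only [nestedQuads, List.forall_mem_cons, List.not_mem_nil,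
      false_imp_iff, implies_true, and_true]
    refine ⟨ha.abc, ha.bcd, ha.cda, ha.dab, ha₁, ha₂, hb.abc, hb.bcd, hb.cda, hb.dab, hb₁, hb₂,
      hpos (by decide) (by decide) (by decide) hin.1,
      hpos (by decide) (by decide) (by decide) hin.2.1,
      hpos (by decide) (by decide) (by decide) hin.2.2.1,
      hpos (by decide) (by decide) (by decide) hin.2.2.2, ?_⟩
    refine ⟨?_, ?_, ?_, ?_, ?_, ?_, ?_, ?_, ?_, ?_, ?_, ?_, ?_, ?_, ?_, ?_, ?_, ?_, ?_, ?_⟩ <;>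
      refine hpos (by decide) (by decide) (by decide) ?_
    iterate 5 exact (hout _).1
    iterate 5 exact (hout _).2.1
    iterate 5 exact (hout _).2.2.1
    iterate 5 exact (hout _).2.2.2
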